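/- arXiv:math/0701352 — 5 statements merged into one kernel-verified Lean document; each statement's English description precedes it below -/
import Mathlib

section
/- Strong subadditivity of quantum entropy: let A be a density matrix (a positive semidefinite matrix with Tr A = 1) indexed by a triple product I×J×K of finite index sets. Let A_{2,3} = Tr_1 A (partial trace over the I factor), A_{1,3} = Tr_2 A (partial trace over the J factor), and A_3 = Tr_1 Tr_2 A (partial trace over both the I and J factors). Then S(A_{1,3}) + S(A_{2,3}) ≥ S(A) + S(A_3). -/
open Matrix
open scoped ComplexOrder

/-- Partial trace over the first factor: `(Tr₁ A)(j,j') = ∑ i, A((i,j),(i,j'))`. -/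
noncomputable def ptraceFst {I J : Type*} [Fintype I]
    (A : Matrix (I × J) (I × J) ℂ) : Matrix J J ℂ :=
  Matrix.of fun j j' => ∑ i, A (i, j) (i, j')

/-- Partial trace over the middle factor of a triple product:
`(Tr_J A)((i,k),(i',k')) = ∑ j, A((i,j,k),(i',j,k'))`. -/
noncomputable def ptraceMid {I J K : Type*} [Fintype J]
    (A : Matrix (I × J × K) (I × J × K) ℂ) : Matrix (I × K) (I × K) ℂ :=
  Matrix.of fun p q => ∑ j, A (p.1, j, p.2) (q.1, j, q.2)

/-- The von Neumann entropy `S(A) = -Tr(A log A)`, computed via the functional calculus: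
for a Hermitian matrix it is `-∑ λᵢ log λᵢ` over the eigenvalues (with the convention
`0 · log 0 = 0`, which holds since `Real.log 0 = 0`); junk value `0` otherwise. -/
noncomputable def vnEntropy {n : Type*} [Fintype n] [DecidableEq n]
    (A : Matrix n n ℂ) : ℝ :=
  if h : A.IsHermitian then -∑ i, h.eigenvalues i * Real.log (h.eigenvalues i) else 0

section PartialTrace

variable {I J K : Type*}

/-- The ampliation `X ↦ 1 ⊗ X` to the outer factors of a triple product. -/
noncomputable def ampliationMid [DecidableEq J] (X : Matrix (I × K) (I × K) ℂ) :
    Matrix (I × J × K) (I × J × K) ℂ :=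
  Matrix.of fun p q => if p.2.1 = q.2.1 then X (p.1, p.2.2) (q.1, q.2.2) else 0

lemma ampliationMid_mul [Fintype I] [Fintype J] [Fintype K] [DecidableEq J]
    (X Y : Matrix (I × K) (I × K) ℂ) :
    ampliationMid (J := J) (X * Y) = ampliationMid X * ampliationMid Y := by
  ext p q
  by_cases h : p.2.1 = q.2.1 <;>
    simp [ampliationMid, Matrix.mul_apply, Fintype.sum_prod_type, h]

lemma ampliationMid_conjTranspose [DecidableEq J] (X : Matrix (I × K) (I × K) ℂ) :
    ampliationMid (J := J) Xᴴ = (ampliationMid X)ᴴ := by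
  ext p q
  by_cases h : p.2.1 = q.2.1
  · simp [ampliationMid, h]
  · simp [ampliationMid, h, Ne.symm h]

lemma trace_mul_ampliationMid [Fintype I] [Fintype J] [Fintype K] [DecidableEq J]
    (A : Matrix (I × J × K) (I × J × K) ℂ)
    (X : Matrix (I × K) (I × K) ℂ) :
    (A * ampliationMid X).trace = (ptraceMid A * X).trace := by
  simp only [Matrix.trace, Matrix.diag, Matrix.mul_apply, Fintype.sum_prod_type, ampliationMid,
    ptraceMid, Matrix.of_apply, Finset.sum_mul, mul_ite, mul_zero]
  refine Finset.sum_congr rfl fun i _ => ?_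
  rw [Finset.sum_comm]
  refine Finset.sum_congr rfl fun k _ => ?_
  rw [Finset.sum_comm]
  refine Finset.sum_congr rfl fun i' _ => ?_
  rw [Finset.sum_comm (s := Finset.univ (α := K))]
  refine Finset.sum_congr rfl fun j _ => ?_
  rw [Finset.sum_comm]
  simp

lemma trace_mul_one_kronecker [Fintype I] [Fintype J] [DecidableEq I] (A : Matrix (I × J) (I × J) ℂ)
    (X : Matrix J J ℂ) :
    (A * kroneckerMap (· * ·) (1 : Matrix I I ℂ) X).trace = (ptraceFst A * X).trace := by
  simp only [Matrix.trace, Matrix.diag, Matrix.mul_apply, Fintype.sum_prod_type,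
    kroneckerMap_apply, Matrix.one_apply, ptraceFst, Matrix.of_apply, Finset.sum_mul, ite_mul,
    one_mul, zero_mul, mul_ite, mul_zero]
  rw [Finset.sum_comm]
  refine Finset.sum_congr rfl fun j _ => ?_
  rw [Finset.sum_comm (s := Finset.univ (α := J))]
  refine Finset.sum_congr rfl fun i _ => ?_
  rw [Finset.sum_comm]
  simp

lemma ptraceMid_one_kronecker [Fintype J] [DecidableEq I] (X : Matrix (J × K) (J × K) ℂ) :
    ptraceMid (kroneckerMap (· * ·) (1 : Matrix I I ℂ) X) =
      kroneckerMap (· * ·) (1 : Matrix I I ℂ) (ptraceFst X) := by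
  ext p q
  simp [ptraceMid, ptraceFst, Finset.mul_sum]

lemma ptraceFst_ptraceMid [Fintype I] [Fintype J] (A : Matrix (I × J × K) (I × J × K) ℂ) :
    ptraceFst (ptraceMid A) = ptraceFst (ptraceFst A) := by
  ext k k'
  simp only [ptraceFst, ptraceMid, Matrix.of_apply]
  exact Finset.sum_comm

lemma ptraceFst_eq_sum_submatrix [Fintype I] (A : Matrix (I × J) (I × J) ℂ) :
    ptraceFst A = ∑ i, A.submatrix (Prod.mk i) (Prod.mk i) := by
  ext j j'
  simp [ptraceFst, Matrix.sum_apply]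

lemma ptraceMid_eq_sum_submatrix [Fintype J] (A : Matrix (I × J × K) (I × J × K) ℂ) :
    ptraceMid A = ∑ j, A.submatrix (fun p => (p.1, j, p.2)) (fun p => (p.1, j, p.2)) := by
  ext p q
  simp [ptraceMid, Matrix.sum_apply]

lemma Matrix.PosSemidef.ptraceFst [Fintype I] {A : Matrix (I × J) (I × J) ℂ} (hA : A.PosSemidef) :
    (ptraceFst A).PosSemidef := by
  rw [ptraceFst_eq_sum_submatrix]
  exact Matrix.posSemidef_sum _ fun i _ => hA.submatrix _

lemma Matrix.PosSemidef.ptraceMid [Fintype J] {A : Matrix (I × J × K) (I × J × K) ℂ}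
    (hA : A.PosSemidef) :
    (ptraceMid A).PosSemidef := by
  rw [ptraceMid_eq_sum_submatrix]
  exact Matrix.posSemidef_sum _ fun j _ => hA.submatrix _

lemma ptraceFst_add_smul_one [Fintype I] [DecidableEq I] [DecidableEq J]
    (A : Matrix (I × J) (I × J) ℂ)
    (c : ℝ) : ptraceFst (A + (c : ℂ) • 1) =
      ptraceFst A + ((Fintype.card I * c : ℝ) : ℂ) • (1 : Matrix J J ℂ) := by
  ext j j'
  simp [ptraceFst, Matrix.one_apply, Finset.sum_add_distrib, mul_ite]

lemma ptraceMid_add_smul_one [Fintype J] [DecidableEq I] [DecidableEq J] [DecidableEq K]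
    (A : Matrix (I × J × K) (I × J × K) ℂ) (c : ℝ) : ptraceMid (A + (c : ℂ) • 1) =
      ptraceMid A + ((Fintype.card J * c : ℝ) : ℂ) • (1 : Matrix (I × K) (I × K) ℂ) := by
  ext p q
  by_cases h : p = q
  · subst h
    simp [ptraceMid, Finset.sum_add_distrib]
  · have h' : ¬(p.1 = q.1 ∧ p.2 = q.2) := fun e => h (Prod.ext e.1 e.2)
    simp [ptraceMid, Matrix.one_apply, h, h']

end PartialTrace

section Spectral

variable {n : Type*} [Fintype n] [DecidableEq n]

/-- The Hermitian matrix `U diag(p) U*` with eigenvalues `p`. -/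
noncomputable def spectralMatrix (U : Matrix n n ℂ) (p : n → ℝ) : Matrix n n ℂ :=
  U * diagonal (fun i => (p i : ℂ)) * Uᴴ

lemma Matrix.IsHermitian.exists_eq_spectralMatrix {A : Matrix n n ℂ} (hA : A.IsHermitian) :
    ∃ U ∈ unitaryGroup n ℂ, A = spectralMatrix U hA.eigenvalues :=
  ⟨hA.eigenvectorUnitary, hA.eigenvectorUnitary.2, by
    have h := hA.spectral_theorem
    rwa [Unitary.conjStarAlgAut_apply] at h⟩

lemma spectralMatrix_add_smul_one {U : Matrix n n ℂ} (hU : U ∈ unitaryGroup n ℂ) (p : n → ℝ)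
    (c : ℝ) : spectralMatrix U p + (c : ℂ) • 1 = spectralMatrix U (fun i => p i + c) := by
  have h : diagonal (fun i => ((p i + c : ℝ) : ℂ)) =
      diagonal (fun i => (p i : ℂ)) + (c : ℂ) • 1 := by
    ext i j
    by_cases h : i = j <;> simp [h]
  rw [spectralMatrix, spectralMatrix, h, Matrix.mul_add, Matrix.add_mul, Matrix.mul_smul,
    Matrix.mul_one, Matrix.smul_mul, show U * Uᴴ = 1 from mem_unitaryGroup_iff.1 hU]

end Spectral

section Variational

variable {n : Type*} [Fintype n]

lemma re_trace_spectralMatrix_mul [DecidableEq n] (U V : Matrix n n ℂ) (p g : n → ℝ) :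
    (spectralMatrix U p * spectralMatrix V g).trace.re =
      ∑ i, ∑ j, Complex.normSq ((Vᴴ * U) j i) * (p i * g j) := by
  have h : (spectralMatrix U p * spectralMatrix V g).trace =
      (diagonal (fun i => (p i : ℂ)) * ((Vᴴ * U)ᴴ *
        (diagonal (fun i => (g i : ℂ)) * (Vᴴ * U)))).trace := by
    simp only [spectralMatrix, Matrix.conjTranspose_mul, Matrix.conjTranspose_conjTranspose,
      Matrix.mul_assoc]
    rw [Matrix.trace_mul_comm]
    simp only [Matrix.mul_assoc]
  rw [h]
  simp only [Matrix.trace, Matrix.diag, Matrix.diagonal_mul, Complex.re_sum]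
  refine Finset.sum_congr rfl fun i _ => ?_
  rw [Matrix.mul_apply, Finset.mul_sum, Complex.re_sum]
  refine Finset.sum_congr rfl fun j _ => ?_
  rw [Matrix.diagonal_mul, Matrix.conjTranspose_apply]
  simp only [Complex.star_def, Complex.normSq_apply, Complex.mul_re, Complex.mul_im,
    Complex.conj_re, Complex.conj_im, Complex.ofReal_re, Complex.ofReal_im]
  ring

lemma sum_normSq_col_eq_one [DecidableEq n] {C : Matrix n n ℂ} (hC : C ∈ unitaryGroup n ℂ) (i : n) :
    ∑ j, Complex.normSq (C j i) = 1 := by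
  have h := congrArg Complex.re (congrFun (congrFun (mem_unitaryGroup_iff'.1 hC) i) i)
  rw [Matrix.mul_apply, Matrix.one_apply_eq, Complex.re_sum, Complex.one_re] at h
  rw [← h]
  refine Finset.sum_congr rfl fun j _ => ?_
  simp [Complex.normSq_apply, Matrix.star_apply]

/-- The quadratic functional whose supremum over `X` is the resolvent form of the relative
modular operator of `ρ` and `σ`. -/
noncomputable def modularFunctional (ρ σ : Matrix n n ℂ) (t : ℝ) (X : Matrix n n ℂ) : ℝ :=
  2 * (ρ * X).trace.re - (σ * (Xᴴ * X)).trace.re - t * (ρ * (X * Xᴴ)).trace.re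

/-- The resolvent form `⟨ρ^(1/2), (Δ + t)⁻¹ ρ^(1/2)⟩` of the relative modular operator `Δ` of
`ρ = U diag(p) U*` and `σ = V diag(q) V*`. -/
noncomputable def modularResolvent (U V : Matrix n n ℂ) (p q : n → ℝ) (t : ℝ) : ℝ :=
  ∑ i, ∑ j, Complex.normSq ((Vᴴ * U) j i) * (p i * (p i / (q j + t * p i)))

lemma modularFunctional_spectralMatrix [DecidableEq n] {U V : Matrix n n ℂ}
    (hU : U ∈ unitaryGroup n ℂ)
    (hV : V ∈ unitaryGroup n ℂ) (p q : n → ℝ) (t : ℝ) (Y : Matrix n n ℂ) :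
    modularFunctional (spectralMatrix U p) (spectralMatrix V q) t (U * Y * Vᴴ) =
      ∑ i, ∑ j, (2 * p i * (Y i j * (Vᴴ * U) j i).re
        - (q j + t * p i) * Complex.normSq (Y i j)) := by
  have hU' : Uᴴ * U = 1 := mem_unitaryGroup_iff'.1 hU
  have hV' : Vᴴ * V = 1 := mem_unitaryGroup_iff'.1 hV
  have hUm (Z : Matrix n n ℂ) : Uᴴ * (U * Z) = Z := by rw [← Matrix.mul_assoc, hU', Matrix.one_mul]
  have hVm (Z : Matrix n n ℂ) : Vᴴ * (V * Z) = Z := by rw [← Matrix.mul_assoc, hV', Matrix.one_mul]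
  have h1 : (spectralMatrix U p * (U * Y * Vᴴ)).trace =
      (diagonal (fun i => (p i : ℂ)) * (Y * (Vᴴ * U))).trace := by
    simp only [spectralMatrix, Matrix.mul_assoc, hUm]
    rw [Matrix.trace_mul_comm]
    simp only [Matrix.mul_assoc]
  have h2 : (spectralMatrix V q * ((U * Y * Vᴴ)ᴴ * (U * Y * Vᴴ))).trace =
      (diagonal (fun i => (q i : ℂ)) * (Yᴴ * Y)).trace := by
    simp only [spectralMatrix, Matrix.conjTranspose_mul, Matrix.conjTranspose_conjTranspose,
      Matrix.mul_assoc, hUm, hVm]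
    rw [Matrix.trace_mul_comm]
    simp only [Matrix.mul_assoc, hV', Matrix.mul_one]
  have h3 : (spectralMatrix U p * ((U * Y * Vᴴ) * (U * Y * Vᴴ)ᴴ)).trace =
      (diagonal (fun i => (p i : ℂ)) * (Y * Yᴴ)).trace := by
    simp only [spectralMatrix, Matrix.conjTranspose_mul, Matrix.conjTranspose_conjTranspose,
      Matrix.mul_assoc, hUm, hVm]
    rw [Matrix.trace_mul_comm]
    simp only [Matrix.mul_assoc, hU', Matrix.mul_one]
  have e1 : (diagonal (fun i => (p i : ℂ)) * (Y * (Vᴴ * U))).trace.re =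
      ∑ i, ∑ j, p i * (Y i j * (Vᴴ * U) j i).re := by
    simp only [Matrix.trace, Matrix.diag, Matrix.diagonal_mul, Complex.re_sum,
      Complex.re_ofReal_mul]
    refine Finset.sum_congr rfl fun i _ => ?_
    rw [Matrix.mul_apply, Complex.re_sum, Finset.mul_sum]
  have e2 : (diagonal (fun i => (q i : ℂ)) * (Yᴴ * Y)).trace.re =
      ∑ i, ∑ j, q j * Complex.normSq (Y i j) := by
    simp only [Matrix.trace, Matrix.diag, Matrix.diagonal_mul, Complex.re_sum,
      Complex.re_ofReal_mul]
    rw [Finset.sum_comm]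
    refine Finset.sum_congr rfl fun i _ => ?_
    rw [Matrix.mul_apply, Complex.re_sum, Finset.mul_sum]
    simp [Complex.normSq_apply]
  have e3 : (diagonal (fun i => (p i : ℂ)) * (Y * Yᴴ)).trace.re =
      ∑ i, ∑ j, p i * Complex.normSq (Y i j) := by
    simp only [Matrix.trace, Matrix.diag, Matrix.diagonal_mul, Complex.re_sum,
      Complex.re_ofReal_mul]
    refine Finset.sum_congr rfl fun i _ => ?_
    rw [Matrix.mul_apply, Complex.re_sum, Finset.mul_sum]
    simp [Complex.normSq_apply]
  rw [modularFunctional, h1, h2, h3, e1, e2, e3]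
  simp only [Finset.mul_sum, ← Finset.sum_sub_distrib]
  refine Finset.sum_congr rfl fun i _ => Finset.sum_congr rfl fun j _ => ?_
  ring

lemma modularFunctional_le_modularResolvent [DecidableEq n] {U V : Matrix n n ℂ}
    (hU : U ∈ unitaryGroup n ℂ)
    (hV : V ∈ unitaryGroup n ℂ) {p q : n → ℝ} (hp : ∀ i, 0 < p i) (hq : ∀ i, 0 < q i)
    {t : ℝ} (ht : 0 ≤ t) (X : Matrix n n ℂ) :
    modularFunctional (spectralMatrix U p) (spectralMatrix V q) t X ≤
      modularResolvent U V p q t := by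
  have hX : X = U * (Uᴴ * X * V) * Vᴴ := by
    have hU' : U * Uᴴ = 1 := mem_unitaryGroup_iff.1 hU
    have hV' : V * Vᴴ = 1 := mem_unitaryGroup_iff.1 hV
    simp only [← Matrix.mul_assoc, hU', Matrix.one_mul]
    rw [Matrix.mul_assoc, hV', Matrix.mul_one]
  rw [hX, modularFunctional_spectralMatrix hU hV, modularResolvent]
  refine Finset.sum_le_sum fun i _ => Finset.sum_le_sum fun j _ => ?_
  generalize (Uᴴ * X * V) i j = y
  generalize (Vᴴ * U) j i = c
  have hd : 0 < q j + t * p i := add_pos_of_pos_of_nonneg (hq j) (mul_nonneg ht (hp i).le)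
  have key : Complex.normSq c * (p i * (p i / (q j + t * p i))) -
      (2 * p i * (y * c).re - (q j + t * p i) * Complex.normSq y) =
      ((p i * c.re - (q j + t * p i) * y.re) ^ 2 + (p i * c.im + (q j + t * p i) * y.im) ^ 2) /
        (q j + t * p i) := by
    have hd' := hd.ne'
    generalize q j + t * p i = d at hd'
    simp only [Complex.normSq_apply, Complex.mul_re]
    field_simp
    ring
  rw [← sub_nonneg, key]
  positivity

lemma exists_modularFunctional_eq_modularResolvent [DecidableEq n] {U V : Matrix n n ℂ}
    (hU : U ∈ unitaryGroup n ℂ) (hV : V ∈ unitaryGroup n ℂ) {p q : n → ℝ} (hp : ∀ i, 0 < p i)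
    (hq : ∀ i, 0 < q i) {t : ℝ} (ht : 0 ≤ t) :
    ∃ X, modularFunctional (spectralMatrix U p) (spectralMatrix V q) t X =
      modularResolvent U V p q t := by
  refine ⟨U * (Matrix.of fun i j =>
    ((p i / (q j + t * p i) : ℝ) : ℂ) * star ((Vᴴ * U) j i)) * Vᴴ, ?_⟩
  rw [modularFunctional_spectralMatrix hU hV, modularResolvent]
  refine Finset.sum_congr rfl fun i _ => Finset.sum_congr rfl fun j _ => ?_
  rw [Matrix.of_apply]
  generalize (Vᴴ * U) j i = c
  have hd : 0 < q j + t * p i := add_pos_of_pos_of_nonneg (hq j) (mul_nonneg ht (hp i).le)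
  simp only [Complex.normSq_apply, Complex.mul_re, Complex.mul_im, Complex.star_def,
    Complex.conj_re, Complex.conj_im, Complex.ofReal_re, Complex.ofReal_im]
  generalize q j + t * p i = d at hd
  field_simp
  ring

/-- The primitive in `t` of the resolvent form. -/
noncomputable def modularLog (U V : Matrix n n ℂ) (p q : n → ℝ) (t : ℝ) : ℝ :=
  ∑ i, ∑ j, Complex.normSq ((Vᴴ * U) j i) * (p i * Real.log (q j + t * p i))

lemma hasDerivAt_modularLog (U V : Matrix n n ℂ) {p q : n → ℝ} (hp : ∀ i, 0 < p i)
    (hq : ∀ i, 0 < q i) {t : ℝ} (ht : 0 ≤ t) :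
    HasDerivAt (modularLog U V p q) (modularResolvent U V p q t) t := by
  unfold modularLog modularResolvent
  refine HasDerivAt.fun_sum fun i _ => HasDerivAt.fun_sum fun j _ => ?_
  have hd : 0 < q j + t * p i := add_pos_of_pos_of_nonneg (hq j) (mul_nonneg ht (hp i).le)
  have h := (((hasDerivAt_id t).mul_const (p i)).const_add (q j)).log hd.ne'
  simpa using (h.const_mul (p i)).const_mul (Complex.normSq ((Vᴴ * U) j i))

lemma sum_sum_normSq_mul [DecidableEq n] {U V : Matrix n n ℂ} (hU : U ∈ unitaryGroup n ℂ)
    (hV : V ∈ unitaryGroup n ℂ) (f : n → ℝ) :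
    ∑ i, ∑ j, Complex.normSq ((Vᴴ * U) j i) * f i = ∑ i, f i := by
  refine Finset.sum_congr rfl fun i _ => ?_
  have hC : Vᴴ * U ∈ unitaryGroup n ℂ := mul_mem (Unitary.star_mem hV) hU
  rw [← Finset.sum_mul, sum_normSq_col_eq_one hC, one_mul]

lemma tendsto_modularLog_sub [DecidableEq n] {U V : Matrix n n ℂ} (hU : U ∈ unitaryGroup n ℂ)
    (hV : V ∈ unitaryGroup n ℂ) {p q : n → ℝ} (hp : ∀ i, 0 < p i) (hq : ∀ i, 0 < q i) :
    Filter.Tendsto (fun t => modularLog U V p q t - (∑ i, p i) * Real.log t) Filter.atTop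
      (nhds (∑ i, p i * Real.log (p i))) := by
  rw [← sum_sum_normSq_mul hU hV fun i => p i * Real.log (p i)]
  have h : Filter.Tendsto (fun t : ℝ => ∑ i, ∑ j, Complex.normSq ((Vᴴ * U) j i) *
      (p i * Real.log (q j / t + p i))) Filter.atTop
      (nhds (∑ i, ∑ j, Complex.normSq ((Vᴴ * U) j i) * (p i * Real.log (p i)))) := by
    refine tendsto_finsetSum _ fun i _ => tendsto_finsetSum _ fun j _ => ?_
    refine Filter.Tendsto.const_mul _ (Filter.Tendsto.const_mul _ ?_)
    refine Filter.Tendsto.log ?_ (hp i).ne'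
    simpa using (Filter.tendsto_id.const_div_atTop (q j)).add_const (p i)
  refine h.congr' ?_
  filter_upwards [Filter.eventually_gt_atTop 0] with t ht
  rw [← sum_sum_normSq_mul hU hV p, modularLog, Finset.sum_mul, ← Finset.sum_sub_distrib]
  refine Finset.sum_congr rfl fun i _ => ?_
  rw [Finset.sum_mul, ← Finset.sum_sub_distrib]
  refine Finset.sum_congr rfl fun j _ => ?_
  have hd : 0 < q j + t * p i := add_pos (hq j) (mul_pos ht (hp i))
  rw [show q j / t + p i = (q j + t * p i) / t by field_simp, Real.log_div hd.ne' ht.ne']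
  ring

end Variational

/-- Monotonicity of the relative entropy under the dual of a multiplicative `*`-preserving map. -/
lemma relativeEntropy_mono {n m : Type*} [Fintype n] [DecidableEq n] [Fintype m] [DecidableEq m]
    {U V : Matrix n n ℂ} (hU : U ∈ unitaryGroup n ℂ) (hV : V ∈ unitaryGroup n ℂ)
    {U' V' : Matrix m m ℂ} (hU' : U' ∈ unitaryGroup m ℂ) (hV' : V' ∈ unitaryGroup m ℂ)
    {p q : n → ℝ} (hp : ∀ i, 0 < p i) (hq : ∀ i, 0 < q i)
    {p' q' : m → ℝ} (hp' : ∀ i, 0 < p' i) (hq' : ∀ i, 0 < q' i)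
    (φ : Matrix m m ℂ → Matrix n n ℂ) (hmul : ∀ X Y, φ (X * Y) = φ X * φ Y)
    (hstar : ∀ X, φ Xᴴ = (φ X)ᴴ)
    (hρ : ∀ X, (spectralMatrix U p * φ X).trace = (spectralMatrix U' p' * X).trace)
    (hσ : ∀ X, (spectralMatrix V q * φ X).trace = (spectralMatrix V' q' * X).trace)
    (hsum : ∑ i, p' i = ∑ i, p i) :
    ∑ i, p' i * Real.log (p' i) -
        (spectralMatrix U' p' * spectralMatrix V' fun i => Real.log (q' i)).trace.re ≤
      ∑ i, p i * Real.log (p i) -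
        (spectralMatrix U p * spectralMatrix V fun i => Real.log (q i)).trace.re := by
  have hres : ∀ t, 0 ≤ t → modularResolvent U' V' p' q' t ≤ modularResolvent U V p q t := by
    intro t ht
    obtain ⟨X, hX⟩ := exists_modularFunctional_eq_modularResolvent hU' hV' hp' hq' ht
    rw [← hX]
    refine le_trans (le_of_eq ?_)
      (modularFunctional_le_modularResolvent hU hV hp hq ht (φ X))
    simp only [modularFunctional, ← hstar, ← hmul, hρ, hσ]
  have hder (t : ℝ) (ht : 0 ≤ t) :=
    (hasDerivAt_modularLog U V hp hq ht).sub (hasDerivAt_modularLog U' V' hp' hq' ht)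
  have hmono : MonotoneOn (modularLog U V p q - modularLog U' V' p' q') (Set.Ici 0) := by
    refine monotoneOn_of_deriv_nonneg (convex_Ici 0)
      (fun t ht => (hder t ht).continuousAt.continuousWithinAt)
      (fun t ht => (hder t (interior_subset ht)).differentiableAt.differentiableWithinAt)
      fun t ht => ?_
    rw [(hder t (interior_subset ht)).deriv]
    exact sub_nonneg.2 (hres t (interior_subset ht))
  have hlim := (tendsto_modularLog_sub hU hV hp hq).sub (tendsto_modularLog_sub hU' hV' hp' hq')
  have h0 := ge_of_tendsto (b := modularLog U V p q 0 - modularLog U' V' p' q' 0) hlim (by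
    filter_upwards [Filter.eventually_ge_atTop 0] with t ht
    have := hmono (Set.mem_Ici.2 le_rfl) ht ht
    simp only [Pi.sub_apply] at this
    rw [hsum]
    linarith)
  rw [re_trace_spectralMatrix_mul, re_trace_spectralMatrix_mul]
  simp only [modularLog, zero_mul, add_zero] at h0
  linarith

section Entropy

variable {n : Type*} [Fintype n] [DecidableEq n]

lemma trace_spectralMatrix {U : Matrix n n ℂ} (hU : U ∈ unitaryGroup n ℂ) (p : n → ℝ) :
    (spectralMatrix U p).trace = ((∑ i, p i : ℝ) : ℂ) := by
  rw [spectralMatrix, Matrix.mul_assoc, Matrix.trace_mul_comm, Matrix.mul_assoc,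
    show Uᴴ * U = 1 from mem_unitaryGroup_iff'.1 hU, Matrix.mul_one, Matrix.trace_diagonal]
  simp

lemma re_trace_spectralMatrix_mul_log {U : Matrix n n ℂ} (hU : U ∈ unitaryGroup n ℂ)
    (p : n → ℝ) : (spectralMatrix U p * spectralMatrix U fun i => Real.log (p i)).trace.re =
      ∑ i, p i * Real.log (p i) := by
  have hU' : Uᴴ * U = 1 := mem_unitaryGroup_iff'.1 hU
  rw [re_trace_spectralMatrix_mul, hU']
  simp [Matrix.one_apply, apply_ite Complex.normSq]

lemma one_kronecker_spectralMatrix {I : Type*} [Fintype I] [DecidableEq I] (U : Matrix n n ℂ)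
    (p : n → ℝ) : kroneckerMap (· * ·) (1 : Matrix I I ℂ) (spectralMatrix U p) =
      spectralMatrix (kroneckerMap (· * ·) (1 : Matrix I I ℂ) U) fun x => p x.2 := by
  have h : diagonal (fun x : I × n => (p x.2 : ℂ)) =
      kroneckerMap (· * ·) (1 : Matrix I I ℂ) (diagonal fun i => (p i : ℂ)) := by
    rw [← Matrix.diagonal_one, Matrix.diagonal_kronecker_diagonal]
    simp
  rw [spectralMatrix, spectralMatrix, h, Matrix.conjTranspose_kronecker,
    ← Matrix.mul_kronecker_mul, ← Matrix.mul_kronecker_mul]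
  simp

lemma one_kronecker_mem_unitaryGroup {I : Type*} [Fintype I] [DecidableEq I]
    {U : Matrix n n ℂ} (hU : U ∈ unitaryGroup n ℂ) :
    kroneckerMap (· * ·) (1 : Matrix I I ℂ) U ∈ unitaryGroup (I × n) ℂ :=
  Matrix.kronecker_mem_unitary (one_mem _) hU

end Entropy

section StrongSubadditivity

variable {I J K : Type*} [Fintype I] [Fintype J] [Fintype K]
  [DecidableEq I] [DecidableEq J] [DecidableEq K]

lemma sum_mul_log_strong_superadditive {A : Matrix (I × J × K) (I × J × K) ℂ}
    {U : Matrix (I × J × K) (I × J × K) ℂ} (hU : U ∈ unitaryGroup _ ℂ)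
    {V : Matrix (J × K) (J × K) ℂ} (hV : V ∈ unitaryGroup _ ℂ)
    {U' : Matrix (I × K) (I × K) ℂ} (hU' : U' ∈ unitaryGroup _ ℂ)
    {V' : Matrix K K ℂ} (hV' : V' ∈ unitaryGroup _ ℂ)
    {p : I × J × K → ℝ} {q : J × K → ℝ} {p' : I × K → ℝ} {q' : K → ℝ}
    (hp : ∀ i, 0 < p i) (hq : ∀ i, 0 < q i) (hp' : ∀ i, 0 < p' i) (hq' : ∀ i, 0 < q' i)
    (hA : A = spectralMatrix U p) (hA₂₃ : ptraceFst A = spectralMatrix V q)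
    (hA₁₃ : ptraceMid A = spectralMatrix U' p')
    (hA₃ : ptraceFst (ptraceFst A) = spectralMatrix V' q') :
    ∑ i, p' i * Real.log (p' i) - ∑ i, q' i * Real.log (q' i) ≤
      ∑ i, p i * Real.log (p i) - ∑ i, q i * Real.log (q i) := by
  have hρ (X : Matrix (I × K) (I × K) ℂ) :
      (spectralMatrix U p * ampliationMid X).trace = (spectralMatrix U' p' * X).trace := by
    rw [← hA, ← hA₁₃, trace_mul_ampliationMid]
  have hsum : ∑ i, p' i = ∑ i, p i := by
    have h : (spectralMatrix U' p').trace = (spectralMatrix U p).trace := by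
      rw [← hA, ← hA₁₃]
      simp only [Matrix.trace, Matrix.diag, ptraceMid, Matrix.of_apply, Fintype.sum_prod_type]
      exact Finset.sum_congr rfl fun i _ => Finset.sum_comm
    rw [trace_spectralMatrix hU, trace_spectralMatrix hU'] at h
    exact_mod_cast h
  have h := relativeEntropy_mono hU (one_kronecker_mem_unitaryGroup (I := I) hV) hU'
    (one_kronecker_mem_unitaryGroup (I := I) hV') hp (q := fun x => q x.2) (fun x => hq x.2)
    hp' (q' := fun x => q' x.2) (fun x => hq' x.2) ampliationMid ampliationMid_mul
    ampliationMid_conjTranspose hρ (fun X => by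
      rw [← one_kronecker_spectralMatrix, ← one_kronecker_spectralMatrix, ← hA₂₃, ← hA₃,
        trace_mul_ampliationMid, ptraceMid_one_kronecker]) hsum
  rw [← one_kronecker_spectralMatrix (p := fun i => Real.log (q' i)),
    ← one_kronecker_spectralMatrix (p := fun i => Real.log (q i)),
    trace_mul_one_kronecker, trace_mul_one_kronecker, ← hA, ← hA₁₃, ptraceFst_ptraceMid, hA₃,
    hA₂₃, re_trace_spectralMatrix_mul_log hV, re_trace_spectralMatrix_mul_log hV'] at h
  exact h

end StrongSubadditivity

lemma tendsto_sum_add_mul_log {n : Type*} [Fintype n] (p : n → ℝ) (c : ℝ) :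
    Filter.Tendsto (fun ε : ℝ => ∑ i, (p i + c * ε) * Real.log (p i + c * ε))
      (nhdsWithin 0 (Set.Ioi 0)) (nhds (∑ i, p i * Real.log (p i))) := by
  have h : Continuous fun ε : ℝ => ∑ i, (p i + c * ε) * Real.log (p i + c * ε) :=
    continuous_finsetSum _ fun i _ => Real.continuous_mul_log.comp (by fun_prop)
  simpa using (h.tendsto 0).mono_left nhdsWithin_le_nhds

/-- **Strong subadditivity of quantum entropy (Lieb–Ruskai):** for a density matrix `A`
on `ℂ^I ⊗ ℂ^J ⊗ ℂ^K`, with `A₂₃ = Tr₁ A`, `A₁₃ = Tr₂ A` (trace over the `J` factor) and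
`A₃ = Tr₁ Tr₂ A`, one has `S(A₁₃) + S(A₂₃) ≥ S(A) + S(A₃)`. -/
theorem strong_subadditivity_entropy {I J K : Type*}
    [Fintype I] [Fintype J] [Fintype K] [DecidableEq I] [DecidableEq J] [DecidableEq K]
    (A : Matrix (I × J × K) (I × J × K) ℂ) (hA : A.PosSemidef) (htr : A.trace = 1) :
    vnEntropy A + vnEntropy (ptraceFst (ptraceFst A))
      ≤ vnEntropy (ptraceMid A) + vnEntropy (ptraceFst A) := by
  have hne : Nonempty (I × J × K) := by
    by_contra h
    rw [not_nonempty_iff] at h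
    simp [Matrix.trace] at htr
  obtain ⟨i₀, j₀, k₀⟩ := hne
  have hI : (0 : ℝ) < Fintype.card I := Nat.cast_pos.2 (Fintype.card_pos_iff.2 ⟨i₀⟩)
  have hJ : (0 : ℝ) < Fintype.card J := Nat.cast_pos.2 (Fintype.card_pos_iff.2 ⟨j₀⟩)
  have h₂₃ := hA.ptraceFst
  have h₁₃ := hA.ptraceMid
  have h₃ := h₂₃.ptraceFst
  obtain ⟨U, hU, eU⟩ := hA.1.exists_eq_spectralMatrix
  obtain ⟨V, hV, eV⟩ := h₂₃.1.exists_eq_spectralMatrix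
  obtain ⟨U', hU', eU'⟩ := h₁₃.1.exists_eq_spectralMatrix
  obtain ⟨V', hV', eV'⟩ := h₃.1.exists_eq_spectralMatrix
  have key : ∀ ε : ℝ, 0 < ε → _ := fun ε hε =>
    sum_mul_log_strong_superadditive (A := A + (ε : ℂ) • 1) hU hV hU' hV'
      (p := fun i => hA.1.eigenvalues i + 1 * ε)
      (q := fun i => h₂₃.1.eigenvalues i + Fintype.card I * ε)
      (p' := fun i => h₁₃.1.eigenvalues i + Fintype.card J * ε)
      (q' := fun i => h₃.1.eigenvalues i + (Fintype.card J * Fintype.card I) * ε)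
      (fun i => add_pos_of_nonneg_of_pos (hA.eigenvalues_nonneg i) (by positivity))
      (fun i => add_pos_of_nonneg_of_pos (h₂₃.eigenvalues_nonneg i) (by positivity))
      (fun i => add_pos_of_nonneg_of_pos (h₁₃.eigenvalues_nonneg i) (by positivity))
      (fun i => add_pos_of_nonneg_of_pos (h₃.eigenvalues_nonneg i) (by positivity))
      (by rw [← spectralMatrix_add_smul_one hU, ← eU, one_mul])
      (by rw [← spectralMatrix_add_smul_one hV, ← eV, ptraceFst_add_smul_one])
      (by rw [← spectralMatrix_add_smul_one hU', ← eU', ptraceMid_add_smul_one])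
      (by rw [← spectralMatrix_add_smul_one hV', ← eV', ptraceFst_add_smul_one,
        ptraceFst_add_smul_one, mul_assoc])
  have hlim := le_of_tendsto_of_tendsto
    ((tendsto_sum_add_mul_log h₁₃.1.eigenvalues _).sub
      (tendsto_sum_add_mul_log h₃.1.eigenvalues _))
    ((tendsto_sum_add_mul_log hA.1.eigenvalues _).sub
      (tendsto_sum_add_mul_log h₂₃.1.eigenvalues _))
    (Filter.eventually_of_mem self_mem_nhdsWithin key)
  rw [vnEntropy, vnEntropy, vnEntropy, vnEntropy, dif_pos hA.1, dif_pos h₂₃.1, dif_pos h₁₃.1,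
    dif_pos h₃.1]
  linarith
end

section
/- For every real p > 1 and all positive semidefinite d×d complex matrices A and C, Tr(A) + Tr(C) ≥ Tr((A^p + C^p)^{1/p}). -/
open Matrix
open scoped ComplexOrder

/-- Matrix power via the functional calculus: for a Hermitian matrix, apply the real
power `x ^ s` to the eigenvalues in its spectral decomposition (so `0 ^ s = 0` for `s > 0`);
junk value `0` for non-Hermitian matrices. -/
noncomputable def matrixRpow {n : Type*} [Fintype n] [DecidableEq n]
    (A : Matrix n n ℂ) (s : ℝ) : Matrix n n ℂ :=
  if h : A.IsHermitian then
    (h.eigenvectorUnitary : Matrix n n ℂ) *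
      Matrix.diagonal (fun i => ((h.eigenvalues i ^ s : ℝ) : ℂ)) *
        (star h.eigenvectorUnitary : Matrix n n ℂ)
  else 0

/-- The diagonal entries of `Qᴴ * diagonal x * Q`. -/
theorem conjTranspose_mul_diagonal_mul_apply_self {m n : Type*} [Fintype m] [DecidableEq m]
    (Q : Matrix m n ℂ) (x : m → ℝ) (j : n) :
    ((Qᴴ * diagonal (fun i => (x i : ℂ)) * Q) j j) = ((∑ i, x i * ‖Q i j‖ ^ 2 : ℝ) : ℂ) := by
  rw [Matrix.mul_apply]
  push_cast
  refine Finset.sum_congr rfl fun i _ => ?_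
  rw [Matrix.mul_diagonal, conjTranspose_apply, ← Complex.conj_mul', Complex.star_def]
  ring

/-- If `Qᴴ * diagonal x * Q ≤ diagonal z`, then each row `q` of `Q` satisfies
`x i * ∑ j, (z j)⁻¹ * ‖q j‖ ^ 2 ≤ 1`. -/
theorem mul_sum_inv_mul_norm_sq_le_one {m n : Type*} [Fintype m] [DecidableEq m] [Fintype n]
    [DecidableEq n] (Q : Matrix m n ℂ) (x : m → ℝ) (z : n → ℝ) (hx : ∀ i, 0 ≤ x i)
    (hz : ∀ j, 0 ≤ z j)
    (h : (diagonal (fun j => (z j : ℂ)) - Qᴴ * diagonal (fun i => (x i : ℂ)) * Q).PosSemidef)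
    (i : m) : x i * ∑ j, (z j)⁻¹ * ‖Q i j‖ ^ 2 ≤ 1 := by
  set t : ℝ := ∑ j, (z j)⁻¹ * ‖Q i j‖ ^ 2 with ht
  have ht0 : 0 ≤ t := Finset.sum_nonneg fun j _ => by have := hz j; positivity
  let v : n → ℂ := fun j => ((z j)⁻¹ : ℝ) * star (Q i j)
  have hdiag : star v ⬝ᵥ (diagonal (fun j => (z j : ℂ)) *ᵥ v) = (t : ℂ) := by
    rw [ht, dotProduct]
    push_cast
    refine Finset.sum_congr rfl fun j _ => ?_
    rw [mulVec_diagonal, ← Complex.mul_conj']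
    simp only [v, Pi.star_apply, star_mul', Complex.star_def, Complex.conj_ofReal, Complex.conj_conj]
    rcases eq_or_ne (z j) 0 with h0 | h0
    · simp [h0]
    · have : (z j : ℂ) ≠ 0 := by exact_mod_cast h0
      push_cast
      field_simp
  have hQv : (Q *ᵥ v) i = (t : ℂ) := by
    rw [ht, mulVec, dotProduct]
    push_cast
    refine Finset.sum_congr rfl fun j _ => ?_
    rw [← Complex.mul_conj']
    simp only [v, Complex.star_def]
    push_cast
    ring
  have hquad : star v ⬝ᵥ ((Qᴴ * diagonal (fun i => (x i : ℂ)) * Q) *ᵥ v)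
      = ((∑ k, x k * ‖(Q *ᵥ v) k‖ ^ 2 : ℝ) : ℂ) := by
    rw [← mulVec_mulVec, ← mulVec_mulVec, dotProduct_mulVec, ← star_mulVec, dotProduct]
    push_cast
    refine Finset.sum_congr rfl fun k _ => ?_
    rw [mulVec_diagonal, ← Complex.conj_mul', Pi.star_apply, Complex.star_def]
    ring
  have hle : ∑ k, x k * ‖(Q *ᵥ v) k‖ ^ 2 ≤ t := by
    have := h.dotProduct_mulVec_nonneg v
    rw [sub_mulVec, dotProduct_sub, hdiag, hquad, sub_nonneg] at this
    exact_mod_cast this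
  have hi : x i * t ^ 2 ≤ t := by
    refine le_trans ?_ hle
    have := Finset.single_le_sum (f := fun k => x k * ‖(Q *ᵥ v) k‖ ^ 2)
      (fun k _ => mul_nonneg (hx k) (by positivity)) (Finset.mem_univ i)
    simpa [hQv] using this
  rcases ht0.eq_or_lt with h0 | h0
  · simp [← h0]
  · nlinarith

/-- If `∑ j, q j ≤ 1` and `x * ∑ j, (z j)⁻¹ * q j ≤ 1`, then
`∑ j, z j ^ (p⁻¹ - 1) * (x * q j) ≤ x ^ p⁻¹`. -/
theorem sum_rpow_sub_one_mul_le {n : Type*} [Fintype n] {p x : ℝ} (hp : 1 < p) (hx : 0 ≤ x)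
    (z q : n → ℝ) (hz : ∀ j, 0 ≤ z j) (hq : ∀ j, 0 ≤ q j) (hsum : ∑ j, q j ≤ 1)
    (h : x * ∑ j, (z j)⁻¹ * q j ≤ 1) :
    ∑ j, z j ^ (p⁻¹ - 1) * (x * q j) ≤ x ^ p⁻¹ := by
  have hp0 : 0 < p := by linarith
  have hp1 : p⁻¹ < 1 := inv_lt_one_of_one_lt₀ hp
  have hw : ∀ j, 0 ≤ x * ((z j)⁻¹ * q j) := fun j => by
    have := hz j; have := hq j; positivity
  have holder := Real.inner_le_weight_mul_Lp_of_nonneg Finset.univ hp.le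
    (fun j => x * ((z j)⁻¹ * q j)) (fun j => z j ^ p⁻¹) hw (fun j => Real.rpow_nonneg (hz j) _)
  calc ∑ j, z j ^ (p⁻¹ - 1) * (x * q j) = ∑ j, x * ((z j)⁻¹ * q j) * z j ^ p⁻¹ := by
        refine Finset.sum_congr rfl fun j _ => ?_
        rcases (hz j).eq_or_lt with h0 | h0
        · simp [← h0, Real.zero_rpow (sub_ne_zero.mpr hp1.ne)]
        · rw [Real.rpow_sub_one h0.ne']
          ring
    _ ≤ _ := holder
    _ ≤ 1 * (∑ j, x * ((z j)⁻¹ * q j) * (z j ^ p⁻¹) ^ p) ^ p⁻¹ := by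
        refine mul_le_mul_of_nonneg_right ?_ (Real.rpow_nonneg (Finset.sum_nonneg fun j _ =>
          mul_nonneg (hw j) (Real.rpow_nonneg (Real.rpow_nonneg (hz j) _) _)) _)
        refine Real.rpow_le_one (Finset.sum_nonneg fun j _ => hw j) ?_ (by linarith)
        rwa [← Finset.mul_sum]
    _ ≤ x ^ p⁻¹ := by
        rw [one_mul]
        refine Real.rpow_le_rpow (Finset.sum_nonneg fun j _ =>
          mul_nonneg (hw j) (Real.rpow_nonneg (Real.rpow_nonneg (hz j) _) _)) ?_ (by positivity)
        calc _ ≤ ∑ j, x * q j := by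
              refine Finset.sum_le_sum fun j _ => ?_
              rw [Real.rpow_inv_rpow (hz j) hp0.ne']
              rcases (hz j).eq_or_lt with h0 | h0
              · simpa [← h0] using mul_nonneg hx (hq j)
              · exact le_of_eq (by field_simp)
          _ ≤ x := by
              rw [← Finset.mul_sum]
              exact mul_le_of_le_one_right hx hsum

theorem sum_norm_sq_row_of_mul_conjTranspose_eq_one {m n : Type*} [Fintype n] [DecidableEq m]
    {Q : Matrix m n ℂ} (hQ : Q * Qᴴ = 1) (i : m) : ∑ j, ‖Q i j‖ ^ 2 = 1 := by
  have h := congrFun (congrFun hQ i) i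
  rw [Matrix.mul_apply, one_apply_eq] at h
  simp only [conjTranspose_apply, Complex.star_def, Complex.mul_conj'] at h
  exact_mod_cast h

section

variable {n : Type*} [Fintype n] [DecidableEq n]

theorem matrixRpow_of_isHermitian {A : Matrix n n ℂ} (h : A.IsHermitian) (s : ℝ) :
    matrixRpow A s = (h.eigenvectorUnitary : Matrix n n ℂ) *
      diagonal (fun i => ((h.eigenvalues i ^ s : ℝ) : ℂ)) *
        (h.eigenvectorUnitary : Matrix n n ℂ)ᴴ := by
  rw [matrixRpow, dif_pos h]
  rfl

theorem posSemidef_matrixRpow {A : Matrix n n ℂ} (hA : A.PosSemidef) (s : ℝ) :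
    (matrixRpow A s).PosSemidef := by
  rw [matrixRpow_of_isHermitian hA.1]
  refine PosSemidef.mul_mul_conjTranspose_same (.diagonal fun i => ?_) _
  exact Complex.zero_le_real.mpr (Real.rpow_nonneg (hA.eigenvalues_nonneg i) s)

theorem trace_matrixRpow {A : Matrix n n ℂ} (h : A.IsHermitian) (s : ℝ) :
    (matrixRpow A s).trace = ((∑ i, h.eigenvalues i ^ s : ℝ) : ℂ) := by
  have hU : (h.eigenvectorUnitary : Matrix n n ℂ)ᴴ * (h.eigenvectorUnitary : Matrix n n ℂ) = 1 :=
    Unitary.coe_star_mul_self _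
  rw [matrixRpow_of_isHermitian h, trace_mul_comm, ← Matrix.mul_assoc, hU, Matrix.one_mul,
    trace_diagonal]
  push_cast
  rfl

theorem eigenvectorUnitary_conjTranspose_mul_mul {A : Matrix n n ℂ} (h : A.IsHermitian) :
    (h.eigenvectorUnitary : Matrix n n ℂ)ᴴ * A * (h.eigenvectorUnitary : Matrix n n ℂ) =
      diagonal (fun i => (h.eigenvalues i : ℂ)) := by
  have := h.conjStarAlgAut_star_eigenvectorUnitary
  rw [Unitary.conjStarAlgAut_star_apply] at this
  exact this

/-- If `A ^ p ≤ Z`, then `Tr (A ^ p * Z ^ (1 / p - 1)) ≤ Tr A`, the left-hand side being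
computed in an eigenbasis of `Z`. -/
theorem sum_eigenvalues_rpow_mul_le_trace {p : ℝ} (hp : 1 < p) {A Z : Matrix n n ℂ}
    (hA : A.PosSemidef) (hZ : Z.PosSemidef) (h : (Z - matrixRpow A p).PosSemidef) :
    ∑ j, hZ.1.eigenvalues j ^ (p⁻¹ - 1) *
      (((hZ.1.eigenvectorUnitary : Matrix n n ℂ)ᴴ * matrixRpow A p *
        (hZ.1.eigenvectorUnitary : Matrix n n ℂ)) j j).re ≤ A.trace.re := by
  set W : Matrix n n ℂ := (hZ.1.eigenvectorUnitary : Matrix n n ℂ) with hW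
  set U : Matrix n n ℂ := (hA.1.eigenvectorUnitary : Matrix n n ℂ) with hU
  set x : n → ℝ := fun i => hA.1.eigenvalues i ^ p with hxdef
  have hx : ∀ i, 0 ≤ x i := fun i => Real.rpow_nonneg (hA.eigenvalues_nonneg i) p
  have hWW : W * Wᴴ = 1 := Unitary.coe_mul_star_self _
  have hUU : Uᴴ * U = 1 := Unitary.coe_star_mul_self _
  have hconj : Wᴴ * matrixRpow A p * W =
      (Uᴴ * W)ᴴ * diagonal (fun i => (x i : ℂ)) * (Uᴴ * W) := by
    rw [matrixRpow_of_isHermitian hA.1, conjTranspose_mul, conjTranspose_conjTranspose]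
    simp only [Matrix.mul_assoc, hU, hxdef]
  have hrow : (Uᴴ * W) * (Uᴴ * W)ᴴ = 1 := by
    rw [conjTranspose_mul, conjTranspose_conjTranspose, Matrix.mul_assoc, ← Matrix.mul_assoc W,
      hWW, Matrix.one_mul, hUU]
  have hpos := h.conjTranspose_mul_mul_same W
  rw [Matrix.mul_sub, Matrix.sub_mul, hconj, eigenvectorUnitary_conjTranspose_mul_mul] at hpos
  have hrows (i : n) := sum_rpow_sub_one_mul_le hp (hx i) hZ.1.eigenvalues
    (fun j => ‖(Uᴴ * W) i j‖ ^ 2) hZ.eigenvalues_nonneg (fun j => by positivity)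
    (sum_norm_sq_row_of_mul_conjTranspose_eq_one hrow i).le
    (mul_sum_inv_mul_norm_sq_le_one _ x _ hx hZ.eigenvalues_nonneg hpos i)
  rw [hconj]
  simp only [conjTranspose_mul_diagonal_mul_apply_self, Complex.ofReal_re, Finset.mul_sum]
  rw [Finset.sum_comm]
  refine (Finset.sum_le_sum fun i _ => hrows i).trans_eq ?_
  rw [hA.1.trace_eq_sum_eigenvalues, Complex.re_sum]
  refine Finset.sum_congr rfl fun i _ => ?_
  exact Real.rpow_rpow_inv (hA.eigenvalues_nonneg i) (by positivity)

end

/-- For `p > 1` and positive semidefinite matrices `A`, `C`: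
`Tr(A) + Tr(C) ≥ Tr((A^p + C^p)^{1/p})`. -/
theorem trace_add_ge_trace_rpow_sum {d : ℕ} (p : ℝ) (hp : 1 < p)
    (A C : Matrix (Fin d) (Fin d) ℂ) (hA : A.PosSemidef) (hC : C.PosSemidef) :
    (matrixRpow (matrixRpow A p + matrixRpow C p) (1 / p)).trace.re
      ≤ A.trace.re + C.trace.re := by
  have hX := posSemidef_matrixRpow hA p
  have hY := posSemidef_matrixRpow hC p
  have hZ := hX.add hY
  have hA' := sum_eigenvalues_rpow_mul_le_trace hp hA hZ (by simpa using hY)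
  have hC' := sum_eigenvalues_rpow_mul_le_trace hp hC hZ (by simpa using hX)
  refine le_of_eq_of_le ?_ (add_le_add hA' hC')
  rw [trace_matrixRpow hZ.1, Complex.ofReal_re, ← Finset.sum_add_distrib]
  refine Finset.sum_congr rfl fun j _ => ?_
  have hp1 : p⁻¹ < 1 := inv_lt_one_of_one_lt₀ hp
  rw [← mul_add, ← Complex.add_re, ← Matrix.add_apply, ← Matrix.add_mul, ← Matrix.mul_add,
    eigenvectorUnitary_conjTranspose_mul_mul, diagonal_apply_eq, Complex.ofReal_re, one_div]
  rcases (hZ.eigenvalues_nonneg j).eq_or_lt with h0 | h0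
  · rw [← h0, mul_zero, Real.zero_rpow (by positivity)]
  · rw [Real.rpow_sub_one h0.ne']
    field_simp
end

section
/- Birman–Koplienko–Solomyak inequality (finite-dimensional case): for every real p > 1 and all positive semidefinite d×d complex matrices A and B, Tr(((B^p − A^p)_+)^{1/p}) ≥ Tr((B − A)_+), where X_+ denotes the positive part of a Hermitian matrix X. -/
open Matrix
open scoped ComplexOrder

/-- The positive part `X₊` of a Hermitian matrix, via the functional calculus applied
to `t ↦ max t 0` on the eigenvalues; junk value `0` for non-Hermitian matrices. -/
noncomputable def matrixPosPart {n : Type*} [Fintype n] [DecidableEq n]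
    (A : Matrix n n ℂ) : Matrix n n ℂ :=
  if h : A.IsHermitian then
    (h.eigenvectorUnitary : Matrix n n ℂ) *
      Matrix.diagonal (fun i => ((max (h.eigenvalues i) 0 : ℝ) : ℂ)) *
        (star h.eigenvectorUnitary : Matrix n n ℂ)
  else 0

section
open scoped MatrixOrder Matrix.Norms.L2Operator
variable {n : Type*} [Fintype n]

theorem Matrix.trace_re_le_of_le {A B : Matrix n n ℂ} (h : A ≤ B) : A.trace.re ≤ B.trace.re := by
  have := (Complex.le_def.1 (PosSemidef.trace_nonneg (le_iff.1 h))).1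
  simpa using this

variable [DecidableEq n]

theorem Matrix.IsHermitian.trace_cfc {A : Matrix n n ℂ} (hA : A.IsHermitian) (f : ℝ → ℝ) :
    (cfc f A).trace = ((∑ i, f (hA.eigenvalues i) : ℝ) : ℂ) := by
  rw [hA.cfc_eq, IsHermitian.cfc, Unitary.conjStarAlgAut_apply, trace_mul_cycle,
    Unitary.coe_star_mul_self, one_mul, trace_diagonal]
  simp

theorem Matrix.IsHermitian.matrixPosPart_eq {A : Matrix n n ℂ} (hA : A.IsHermitian) :
    matrixPosPart A = cfc (fun x : ℝ => max x 0) A := by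
  rw [matrixPosPart, dif_pos hA, hA.cfc_eq, IsHermitian.cfc, Unitary.conjStarAlgAut_apply]
  rfl

theorem Matrix.PosSemidef.matrixRpow_eq {A : Matrix n n ℂ} (hA : A.PosSemidef) (s : ℝ) :
    matrixRpow A s = A ^ s := by
  rw [matrixRpow, dif_pos hA.isHermitian, CFC.rpow_eq_cfc_real hA.nonneg, hA.isHermitian.cfc_eq,
    IsHermitian.cfc, Unitary.conjStarAlgAut_apply]
  rfl

theorem Matrix.trace_mul_re_le_of_le {A B C : Matrix n n ℂ} (h : A ≤ B) (hC : 0 ≤ C) :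
    (A * C).trace.re ≤ (B * C).trace.re := by
  have key := trace_re_le_of_le (conjugate_le_conjugate_of_nonneg h (CFC.sqrt_nonneg C))
  rwa [trace_mul_cycle, CFC.sqrt_mul_sqrt_self C, trace_mul_comm, trace_mul_cycle _ B,
    CFC.sqrt_mul_sqrt_self C, trace_mul_comm C B] at key

/-- The trace of the positive part of `H` is at most the trace of any positive semidefinite
majorant of `H`. -/
theorem Matrix.trace_matrixPosPart_re_le {H K : Matrix n n ℂ} (hH : H.IsHermitian) (hHK : H ≤ K)
    (hK : 0 ≤ K) : (matrixPosPart H).trace.re ≤ K.trace.re := by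
  set U := (hH.eigenvectorUnitary : Matrix n n ℂ)
  have hUU : U * star U = 1 := Unitary.coe_mul_star_self _
  have hdiag : star U * H * U = diagonal (fun i => (hH.eigenvalues i : ℂ)) := by
    simpa [Unitary.conjStarAlgAut_apply, Function.comp_def] using
      hH.conjStarAlgAut_star_eigenvectorUnitary
  have htr : K.trace = (star U * K * U).trace := by
    rw [trace_mul_cycle, hUU, one_mul]
  rw [hH.matrixPosPart_eq, hH.trace_cfc, htr, Complex.ofReal_re, trace, Complex.re_sum]
  refine Finset.sum_le_sum fun i _ => max_le ?_ ?_
  · have h := (Complex.le_def.1 ((le_iff.1 (star_left_conjugate_le_conjugate hHK U)).diag_nonneg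
      (i := i))).1
    rw [hdiag] at h
    simpa using h
  · exact (Complex.le_def.1 ((nonneg_iff_posSemidef.1
      (star_left_conjugate_nonneg hK U)).diag_nonneg (i := i))).1

theorem Matrix.rpow_sub_one_anti {q : ℝ} (hq : q ∈ Set.Ioo (0 : ℝ) 1) {Y S : Matrix n n ℂ}
    (hY : IsStrictlyPositive Y) (hYS : Y ≤ S) : S ^ (q - 1) ≤ Y ^ (q - 1) := by
  have hS : IsStrictlyPositive S := hY.of_le hYS
  have h1 : (1 - q) ≠ 0 := by linarith [hq.2]
  have h : Y ^ (1 - q) ≤ S ^ (1 - q) :=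
    CFC.rpow_le_rpow ⟨by linarith [hq.2], by linarith [hq.1]⟩ hYS
  have hpos : IsStrictlyPositive (Y ^ (1 - q)) :=
    (IsStrictlyPositive.iff_of_unital).2 ⟨CFC.rpow_nonneg, hY.isUnit.cfcRpow _ hY.nonneg⟩
  have := CStarAlgebra.rpow_neg_one_le_rpow_neg_one h hpos
  rwa [CFC.rpow_rpow _ _ _ h1 hY, CFC.rpow_rpow _ _ _ h1 hS, mul_neg_one, neg_sub] at this

theorem Matrix.trace_rpow_add_re_le_of_isStrictlyPositive {q : ℝ} (hq : q ∈ Set.Ioo (0 : ℝ) 1)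
    {Y Z : Matrix n n ℂ} (hY : IsStrictlyPositive Y) (hZ : IsStrictlyPositive Z) :
    ((Y + Z) ^ q).trace.re ≤ (Y ^ q).trace.re + (Z ^ q).trace.re := by
  have hYS : Y ≤ Y + Z := le_add_of_nonneg_right hZ.nonneg
  have hZS : Z ≤ Y + Z := le_add_of_nonneg_left hY.nonneg
  have split : ∀ {W : Matrix n n ℂ}, IsStrictlyPositive W → W ^ q = W ^ (q - 1) * W := by
    intro W hW
    have h := CFC.rpow_add (x := q - 1) (y := 1) hW.isUnit
    rwa [sub_add_cancel, CFC.rpow_one W hW.nonneg] at h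
  rw [split (hY.of_le hYS), split hY, split hZ, mul_add, trace_add, Complex.add_re]
  exact add_le_add (trace_mul_re_le_of_le (rpow_sub_one_anti hq hY hYS) hY.nonneg)
    (trace_mul_re_le_of_le (rpow_sub_one_anti hq hZ hZS) hZ.nonneg)

theorem Matrix.tendsto_trace_rpow_add_algebraMap {q : ℝ} (hq : 0 < q) {Y : Matrix n n ℂ}
    (hY : 0 ≤ Y) :
    Filter.Tendsto (fun ε : ℝ => ((Y + algebraMap ℝ _ ε) ^ q).trace.re)
      (nhdsWithin 0 (Set.Ioi 0)) (nhds (Y ^ q).trace.re) := by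
  have hYH : Y.IsHermitian := (nonneg_iff_posSemidef.1 hY).isHermitian
  have hcont : Continuous fun ε : ℝ => ∑ i, (hYH.eigenvalues i + ε) ^ q :=
    continuous_finsetSum _ fun i _ => (continuous_const.add continuous_id).rpow_const
      fun _ => Or.inr hq.le
  have hlim := (hcont.tendsto 0).mono_left (nhdsWithin_le_nhds (s := Set.Ioi 0))
  have h0 : (Y ^ q).trace.re = ∑ i, (hYH.eigenvalues i + 0) ^ q := by
    rw [CFC.rpow_eq_cfc_real hY, hYH.trace_cfc, Complex.ofReal_re]
    simp
  rw [h0]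
  refine hlim.congr' ?_
  filter_upwards [self_mem_nhdsWithin] with ε hε
  have hcfc : Y + algebraMap ℝ _ ε = cfc (fun x : ℝ => x + ε) Y := by
    rw [cfc_add_const ε (fun x : ℝ => x) Y, cfc_id' ℝ Y]
  rw [hcfc, CFC.cfc_rpow fun x hx =>
      add_pos_of_nonneg_of_pos (spectrum_nonneg_of_nonneg hY hx) hε,
    hYH.trace_cfc, Complex.ofReal_re]

/-- Rotfeld inequality for powers: `W ↦ Tr (W ^ q)` is subadditive for `0 < q < 1`. -/
theorem Matrix.trace_rpow_add_re_le {q : ℝ} (hq : q ∈ Set.Ioo (0 : ℝ) 1) {Y Z : Matrix n n ℂ}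
    (hY : 0 ≤ Y) (hZ : 0 ≤ Z) :
    ((Y + Z) ^ q).trace.re ≤ (Y ^ q).trace.re + (Z ^ q).trace.re := by
  refine ge_of_tendsto ((tendsto_trace_rpow_add_algebraMap hq.1 hY).add
    (tendsto_trace_rpow_add_algebraMap hq.1 hZ)) ?_
  filter_upwards [self_mem_nhdsWithin] with ε hε
  have hpos : IsStrictlyPositive (algebraMap ℝ (Matrix n n ℂ) ε) :=
    isStrictlyPositive_algebraMap hε
  have hYε := hpos.nonneg_add hY
  have hZε := hpos.nonneg_add hZ
  refine le_trans (trace_re_le_of_le (CFC.rpow_le_rpow ⟨hq.1.le, hq.2.le⟩ ?_))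
    (trace_rpow_add_re_le_of_isStrictlyPositive hq hYε hZε)
  exact add_le_add (le_add_of_nonneg_right hpos.nonneg) (le_add_of_nonneg_right hpos.nonneg)

theorem Matrix.trace_matrixPosPart_rpow_sub_rpow_re_le {q : ℝ} (hq : q ∈ Set.Ioo (0 : ℝ) 1)
    {X Y : Matrix n n ℂ} (hX : 0 ≤ X) (hY : 0 ≤ Y) :
    (matrixPosPart (X ^ q - Y ^ q)).trace.re ≤ (matrixRpow (matrixPosPart (X - Y)) q).trace.re := by
  have hq' : q ∈ Set.Icc (0 : ℝ) 1 := ⟨hq.1.le, hq.2.le⟩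
  have herm : ∀ {V W : Matrix n n ℂ}, 0 ≤ V → 0 ≤ W → (V - W).IsHermitian := fun hV hW =>
    (nonneg_iff_posSemidef.1 hV).isHermitian.sub (nonneg_iff_posSemidef.1 hW).isHermitian
  have hD := herm hX hY
  set Z := matrixPosPart (X - Y) with hZdef
  rw [hD.matrixPosPart_eq] at hZdef
  have hZ : 0 ≤ Z := hZdef ▸ cfc_nonneg fun x _ => le_max_right x 0
  have hXYZ : X ≤ Y + Z := by
    rw [← sub_le_iff_le_add', hZdef]
    nth_rw 1 [← cfc_id' ℝ (X - Y) hD.isSelfAdjoint]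
    exact cfc_mono fun x _ => le_max_left x 0
  have hle := trace_matrixPosPart_re_le (herm CFC.rpow_nonneg CFC.rpow_nonneg)
    (sub_le_sub_right (CFC.rpow_le_rpow hq' hXYZ) (Y ^ q))
    (sub_nonneg.2 (CFC.rpow_le_rpow hq' (le_add_of_nonneg_right hZ)))
  rw [trace_sub, Complex.sub_re] at hle
  rw [(nonneg_iff_posSemidef.1 hZ).matrixRpow_eq]
  linarith [trace_rpow_add_re_le hq hY hZ]

theorem Matrix.PosSemidef.matrixRpow_rpow_one_div {A : Matrix n n ℂ} (hA : A.PosSemidef) {p : ℝ}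
    (hp : 0 < p) : matrixRpow A p ^ (1 / p) = A := by
  rw [hA.matrixRpow_eq, CFC.rpow_rpow_of_exponent_nonneg _ _ _ hp.le (by positivity) hA.nonneg,
    mul_one_div_cancel hp.ne', CFC.rpow_one A hA.nonneg]

theorem Matrix.PosSemidef.matrixRpow_nonneg {A : Matrix n n ℂ} (hA : A.PosSemidef) (p : ℝ) :
    0 ≤ matrixRpow A p :=
  hA.matrixRpow_eq p ▸ CFC.rpow_nonneg

end

/-- **Birman–Koplienko–Solomyak inequality (finite-dimensional case):** for `p > 1` and
positive semidefinite matrices `A`, `B`,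
`Tr(((B^p − A^p)₊)^{1/p}) ≥ Tr((B − A)₊)`. -/
theorem bks_inequality {d : ℕ} (p : ℝ) (hp : 1 < p)
    (A B : Matrix (Fin d) (Fin d) ℂ) (hA : A.PosSemidef) (hB : B.PosSemidef) :
    (matrixPosPart (B - A)).trace.re
      ≤ (matrixRpow (matrixPosPart (matrixRpow B p - matrixRpow A p)) (1 / p)).trace.re := by
  have hp0 : 0 < p := one_pos.trans hp
  have h := trace_matrixPosPart_rpow_sub_rpow_re_le
    ⟨one_div_pos.2 hp0, (div_lt_one hp0).2 hp⟩ (hB.matrixRpow_nonneg p) (hA.matrixRpow_nonneg p)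
  rwa [hB.matrixRpow_rpow_one_div hp0, hA.matrixRpow_rpow_one_div hp0] at h
end

section
/- Averaging formula for the partial trace: let A be a matrix indexed by I×J where J has N elements (an operator on ℂ^I ⊗ ℂ^J). For a permutation π of J and a sign function ε : J → {+1, −1}, let W_{π,ε} be the J×J signed permutation matrix with entries W_{π,ε}(j', j) = ε(j) if j' = π(j) and 0 otherwise. Then (1/(2^N · N!)) · ∑_{π, ε} (I ⊗ W_{π,ε})^* · A · (I ⊗ W_{π,ε}) = (1/N) · (Tr_2 A) ⊗ I_J; entrywise, for all i, i' ∈ I and j, j' ∈ J, the ((i,j),(i',j')) entry of the left-hand side equals δ_{j,j'} · (1/N) · ∑_{k∈J} A((i,k),(i',k)). -/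
open Matrix
open scoped Kronecker

/-- Partial trace over the second factor: `(Tr₂ A)(i,i') = ∑ j, A((i,j),(i',j))`. -/
noncomputable def ptraceSnd {I J : Type*} [Fintype J]
    (A : Matrix (I × J) (I × J) ℂ) : Matrix I I ℂ :=
  Matrix.of fun i i' => ∑ j, A (i, j) (i', j)

/-- The signed permutation matrix associated to a permutation `π` of `J` and a sign
function `ε : J → Bool` (`true ↦ +1`, `false ↦ -1`):
`W(j', j) = ε(j)` if `j' = π j` and `0` otherwise. -/
def signedPermMatrix {J : Type*} [DecidableEq J] (π : Equiv.Perm J) (ε : J → Bool) :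
    Matrix J J ℂ :=
  Matrix.of fun j' j => if j' = π j then (if ε j then 1 else -1) else 0

/-- Conjugating by `1 ⊗ W` permutes the `J`-indices and multiplies by the two signs. -/
theorem conj_one_kronecker_signedPermMatrix_apply {I J : Type*} [Fintype I] [Fintype J]
    [DecidableEq I] [DecidableEq J] (A : Matrix (I × J) (I × J) ℂ) (π : Equiv.Perm J)
    (ε : J → Bool) (i i' : I) (j j' : J) :
    (((1 : Matrix I I ℂ) ⊗ₖ signedPermMatrix π ε)ᴴ * A *
        ((1 : Matrix I I ℂ) ⊗ₖ signedPermMatrix π ε)) (i, j) (i', j') =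
      ((if ε j then 1 else -1) * (if ε j' then 1 else -1)) * A (i, π j) (i', π j') := by
  simp only [Matrix.mul_apply, Matrix.conjTranspose_apply, Matrix.kroneckerMap_apply,
    signedPermMatrix, Matrix.of_apply, Matrix.one_apply, Fintype.sum_prod_type,
    apply_ite star, star_zero, star_one, ite_mul, mul_ite, zero_mul, mul_zero, one_mul,
    mul_one, Finset.sum_ite_eq', Finset.mem_univ, if_true,
    Finset.sum_ite_irrel]
  cases ε j <;> cases ε j' <;> simp

/-- Orthogonality of the coordinate signs on the cube `J → Bool`. -/
theorem sum_sign_mul_sign {J : Type*} [Fintype J] [DecidableEq J] (j j' : J) :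
    ∑ ε : J → Bool, ((if ε j then 1 else -1) * (if ε j' then 1 else -1) : ℂ) =
      if j = j' then 2 ^ Fintype.card J else 0 := by
  split_ifs with h
  · subst h
    have hsq (b : Bool) : ((if b then 1 else -1) * (if b then 1 else -1) : ℂ) = 1 := by
      cases b <;> simp
    simp [hsq]
  · refine Finset.sum_involution (fun ε _ => Function.update ε j (!ε j)) ?_ ?_ ?_ ?_
    · intro ε _
      rw [Function.update_self, Function.update_of_ne (Ne.symm h)]
      cases ε j <;> cases ε j' <;> simp
    · intro ε _ _ heq
      simpa using congrFun heq j
    · simp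
    · simp

/-- Summing `f (π j)` over all permutations `π` weights each value of `f` equally. -/
theorem card_mul_sum_perm_apply {J : Type*} [Fintype J] [DecidableEq J] (f : J → ℂ) (j : J) :
    (Fintype.card J : ℂ) * ∑ π : Equiv.Perm J, f (π j) =
      (Fintype.card J).factorial * ∑ k, f k := by
  have hindep (k : J) : ∑ π : Equiv.Perm J, f (π k) = ∑ π : Equiv.Perm J, f (π j) :=
    Fintype.sum_equiv (Equiv.mulRight (Equiv.swap j k)) _ _ (by simp)
  calc (Fintype.card J : ℂ) * ∑ π : Equiv.Perm J, f (π j)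
      = ∑ k : J, ∑ π : Equiv.Perm J, f (π k) := by simp [hindep]
    _ = ∑ π : Equiv.Perm J, ∑ k : J, f (π k) := Finset.sum_comm
    _ = (Fintype.card J).factorial * ∑ k, f k := by
      simp [Equiv.sum_comp, Fintype.card_perm]

/-- **Averaging formula for the partial trace:** for a matrix `A` indexed by `I × J`
with `N = card J`, averaging the conjugates `(I ⊗ W)ᴴ A (I ⊗ W)` over all `2^N · N!`
signed permutation matrices `W` of `J` yields `(1/N) · (Tr₂ A) ⊗ I_J`; entrywise, the
`((i,j),(i',j'))` entry of the average is `δ_{j,j'} · (1/N) · ∑ k, A((i,k),(i',k))`. -/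
theorem ptrace_averaging_formula {I J : Type*} [Fintype I] [Fintype J]
    [DecidableEq I] [DecidableEq J]
    (A : Matrix (I × J) (I × J) ℂ) :
    ((2 ^ Fintype.card J * (Nat.factorial (Fintype.card J)) : ℂ)⁻¹ •
        ∑ π : Equiv.Perm J, ∑ ε : J → Bool,
          ((1 : Matrix I I ℂ) ⊗ₖ signedPermMatrix π ε)ᴴ * A *
            ((1 : Matrix I I ℂ) ⊗ₖ signedPermMatrix π ε))
      = ((Fintype.card J : ℂ))⁻¹ • (ptraceSnd A ⊗ₖ (1 : Matrix J J ℂ)) ∧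
    ∀ (i i' : I) (j j' : J),
      ((2 ^ Fintype.card J * (Nat.factorial (Fintype.card J)) : ℂ)⁻¹ •
          ∑ π : Equiv.Perm J, ∑ ε : J → Bool,
            ((1 : Matrix I I ℂ) ⊗ₖ signedPermMatrix π ε)ᴴ * A *
              ((1 : Matrix I I ℂ) ⊗ₖ signedPermMatrix π ε)) (i, j) (i', j')
        = if j = j' then ((Fintype.card J : ℂ))⁻¹ * ∑ k, A (i, k) (i', k) else 0 := by
  have hentry (i i' : I) (j j' : J) :
      ((2 ^ Fintype.card J * (Nat.factorial (Fintype.card J)) : ℂ)⁻¹ •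
          ∑ π : Equiv.Perm J, ∑ ε : J → Bool,
            ((1 : Matrix I I ℂ) ⊗ₖ signedPermMatrix π ε)ᴴ * A *
              ((1 : Matrix I I ℂ) ⊗ₖ signedPermMatrix π ε)) (i, j) (i', j')
        = if j = j' then ((Fintype.card J : ℂ))⁻¹ * ∑ k, A (i, k) (i', k) else 0 := by
    simp only [Matrix.smul_apply, Matrix.sum_apply, conj_one_kronecker_signedPermMatrix_apply,
      ← Finset.sum_mul, sum_sign_mul_sign, smul_eq_mul]
    split_ifs with h
    · subst h
      have hcard : (Fintype.card J : ℂ) ≠ 0 :=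
        Nat.cast_ne_zero.mpr (Fintype.card_pos_iff.mpr ⟨j⟩).ne'
      have hfact : ((Fintype.card J).factorial : ℂ) ≠ 0 :=
        Nat.cast_ne_zero.mpr (Nat.factorial_ne_zero _)
      have hsum := card_mul_sum_perm_apply (fun k => A (i, k) (i', k)) j
      rw [← Finset.mul_sum]
      field_simp
      linear_combination hsum
    · simp
  refine ⟨?_, hentry⟩
  ext ⟨i, j⟩ ⟨i', j'⟩
  rw [hentry]
  simp [ptraceSnd, Matrix.one_apply]
end

section
/- Strong subadditivity of classical entropy: let (X,μ), (Y,ν), (Z,ρ) be σ-finite measure spaces and let f : X×Y×Z → [0,∞) be a probability density with respect to the product measure μ×ν×ρ. Define the marginal densities f_{2,3}(y,z) = ∫_X f dμ, f_{1,3}(x,z) = ∫_Y f dν, and f_3(z) = ∫_X ∫_Y f dμ dν. Assume that f·log f, f_{1,3}·log f_{1,3}, f_{2,3}·log f_{2,3}, and f_3·log f_3 are integrable with respect to the corresponding (product) measures. Then S(f_{1,3}) + S(f_{2,3}) ≥ S(f) + S(f_3). -/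
open MeasureTheory

/-- The entropy `S(g) = -∫ g log g dμ` of a density `g` on a measure space `(α, μ)`
(with the convention `0 · log 0 = 0`, which holds since `Real.log 0 = 0`). -/
noncomputable def entropyOf {α : Type*} [MeasurableSpace α] (μ : Measure α) (g : α → ℝ) : ℝ :=
  -∫ a, g a * Real.log (g a) ∂μ

section Marginal

variable {A B C : Type*} [MeasurableSpace A] [MeasurableSpace B] [MeasurableSpace C]

/-- Integrating a nonnegative `F` against a function of the second variable only is integrating
the second marginal of `F` against that function. -/
theorem integrable_mul_comp_snd_and_integral_eq
    (μ : Measure A) (ν : Measure B) [SigmaFinite μ] [SigmaFinite ν]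
    {F : A × B → ℝ} (hF : Measurable F) (hF_nonneg : ∀ w, 0 ≤ F w)
    (hslice : ∀ᵐ b ∂ν, Integrable (fun a => F (a, b)) μ)
    {h : B → ℝ} (hh : Measurable h)
    (hint : Integrable (fun b => (∫ a, F (a, b) ∂μ) * h b) ν) :
    Integrable (fun w => F w * h w.2) (μ.prod ν) ∧
      ∫ w, F w * h w.2 ∂(μ.prod ν) = ∫ b, (∫ a, F (a, b) ∂μ) * h b ∂ν := by
  have hmeas : Measurable (fun w : A × B => F w * h w.2) := hF.mul (hh.comp measurable_snd)
  have hI : Integrable (fun w : A × B => F w * h w.2) (μ.prod ν) := by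
    rw [integrable_prod_iff' hmeas.aestronglyMeasurable]
    refine ⟨hslice.mono fun b hb => hb.mul_const (h b), ?_⟩
    refine hint.norm.congr (Filter.Eventually.of_forall fun b => ?_)
    simp only [norm_mul, integral_mul_const, Real.norm_of_nonneg (hF_nonneg _),
      Real.norm_of_nonneg (integral_nonneg fun a => hF_nonneg (a, b))]
  refine ⟨hI, ?_⟩
  rw [integral_prod_symm _ hI]
  simp only [integral_mul_const]

theorem measurePreserving_prod_left_comm
    (μ : Measure A) (ν : Measure B) (ρ : Measure C)
    [SigmaFinite μ] [SigmaFinite ν] [SigmaFinite ρ] :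
    MeasurePreserving (fun w : B × A × C => (w.2.1, w.1, w.2.2))
      (ν.prod (μ.prod ρ)) (μ.prod (ν.prod ρ)) :=
  (measurePreserving_prodAssoc μ ν ρ).comp
    (((Measure.measurePreserving_swap (μ := ν) (ν := μ)).prod (MeasurePreserving.id ρ)).comp
      ((measurePreserving_prodAssoc ν μ ρ).symm MeasurableEquiv.prodAssoc))

/-- Integrating a nonnegative `F` against a function of the first and third variables is
integrating the corresponding marginal of `F` against that function. -/
theorem integrable_mul_comp_fst_thd_and_integral_eq
    (μ : Measure A) (ν : Measure B) (ρ : Measure C)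
    [SigmaFinite μ] [SigmaFinite ν] [SigmaFinite ρ]
    {F : A × B × C → ℝ} (hF : Measurable F) (hF_nonneg : ∀ w, 0 ≤ F w)
    (hF_int : Integrable F (μ.prod (ν.prod ρ)))
    {h : A × C → ℝ} (hh : Measurable h)
    (hint : Integrable (fun q => (∫ b, F (q.1, b, q.2) ∂ν) * h q) (μ.prod ρ)) :
    Integrable (fun w => F w * h (w.1, w.2.2)) (μ.prod (ν.prod ρ)) ∧
      ∫ w, F w * h (w.1, w.2.2) ∂(μ.prod (ν.prod ρ))
        = ∫ q, (∫ b, F (q.1, b, q.2) ∂ν) * h q ∂(μ.prod ρ) := by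
  have he := measurePreserving_prod_left_comm μ ν ρ
  have hmeas : Measurable (fun w : A × B × C => F w * h (w.1, w.2.2)) := by fun_prop
  have hcomp := integrable_mul_comp_snd_and_integral_eq ν (μ.prod ρ)
    (F := fun w => F (w.2.1, w.1, w.2.2)) (by fun_prop) (fun w => hF_nonneg _)
    ((he.integrable_comp hF.aestronglyMeasurable).2 hF_int).prod_left_ae hh hint
  refine ⟨(he.integrable_comp hmeas.aestronglyMeasurable).1 hcomp.1, ?_⟩
  rw [← hcomp.2, ← he.map_eq, integral_map he.measurable.aemeasurable
    hmeas.aestronglyMeasurable]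

end Marginal

theorem sub_le_mul_log_add_mul_log_sub {a p q r : ℝ} (ha : 0 ≤ a) (hp : 0 ≤ p) (hq : 0 ≤ q)
    (hr : 0 ≤ r) (hap : p = 0 → a = 0) (haq : q = 0 → a = 0) (har : r = 0 → a = 0) :
    a - p * (q / r) ≤
      a * Real.log a + a * Real.log r - a * Real.log p - a * Real.log q := by
  rcases ha.eq_or_lt with rfl | ha
  · have : 0 ≤ p * (q / r) := by positivity
    simpa using this
  have hp : 0 < p := hp.lt_of_ne fun h => ha.ne' (hap h.symm)
  have hq : 0 < q := hq.lt_of_ne fun h => ha.ne' (haq h.symm)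
  have hr : 0 < r := hr.lt_of_ne fun h => ha.ne' (har h.symm)
  have hlog := Real.log_le_sub_one_of_pos (x := p * (q / r) / a) (by positivity)
  rw [Real.log_div (by positivity) ha.ne', Real.log_mul hp.ne' (by positivity),
    Real.log_div hq.ne' hr.ne'] at hlog
  have hmul := mul_le_mul_of_nonneg_left hlog ha.le
  have hcancel : a * (p * (q / r) / a - 1) = p * (q / r) - a := by field_simp
  rw [hcancel] at hmul
  linarith

/-- **Strong subadditivity of classical entropy:** for a probability density `f` on the
product of three σ-finite measure spaces, with marginals
`f₂₃(y,z) = ∫ f dμ`, `f₁₃(x,z) = ∫ f dν`, `f₃(z) = ∫∫ f dμ dν`, and assuming the relevant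
`g log g` integrabilities, one has `S(f₁₃) + S(f₂₃) ≥ S(f) + S(f₃)`. -/
theorem strong_subadditivity_classical_entropy
    {X Y Z : Type*} [MeasurableSpace X] [MeasurableSpace Y] [MeasurableSpace Z]
    (μ : Measure X) (ν : Measure Y) (ρ : Measure Z)
    [SigmaFinite μ] [SigmaFinite ν] [SigmaFinite ρ]
    (f : X × Y × Z → ℝ) (hf_meas : Measurable f) (hf_nonneg : ∀ w, 0 ≤ f w)
    (hf_prob : ∫ w, f w ∂(μ.prod (ν.prod ρ)) = 1)
    (f₂₃ : Y × Z → ℝ) (hf₂₃ : f₂₃ = fun q => ∫ x, f (x, q.1, q.2) ∂μ)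
    (f₁₃ : X × Z → ℝ) (hf₁₃ : f₁₃ = fun q => ∫ y, f (q.1, y, q.2) ∂ν)
    (f₃ : Z → ℝ) (hf₃ : f₃ = fun z => ∫ x, ∫ y, f (x, y, z) ∂ν ∂μ)
    (hint : Integrable (fun w => f w * Real.log (f w)) (μ.prod (ν.prod ρ)))
    (hint₁₃ : Integrable (fun q => f₁₃ q * Real.log (f₁₃ q)) (μ.prod ρ))
    (hint₂₃ : Integrable (fun q => f₂₃ q * Real.log (f₂₃ q)) (ν.prod ρ))
    (hint₃ : Integrable (fun z => f₃ z * Real.log (f₃ z)) ρ) :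
    entropyOf (μ.prod (ν.prod ρ)) f + entropyOf ρ f₃
      ≤ entropyOf (μ.prod ρ) f₁₃ + entropyOf (ν.prod ρ) f₂₃ := by
  have hf_int : Integrable f (μ.prod (ν.prod ρ)) :=
    Integrable.of_integral_ne_zero (by rw [hf_prob]; exact one_ne_zero)
  have he := measurePreserving_prod_left_comm μ ν ρ
  have hm₂₃ : Measurable f₂₃ := by
    rw [hf₂₃]
    exact hf_meas.stronglyMeasurable.integral_prod_left'.measurable
  have hm₁₃ : Measurable f₁₃ := by
    rw [hf₁₃]
    exact (hf_meas.comp he.measurable).stronglyMeasurable.integral_prod_left'.measurable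
  have hf₃' : f₃ = fun z => ∫ x, f₁₃ (x, z) ∂μ := by rw [hf₃, hf₁₃]
  have hm₃ : Measurable f₃ := by
    rw [hf₃']
    exact hm₁₃.stronglyMeasurable.integral_prod_left'.measurable
  have hn₂₃ : ∀ q, 0 ≤ f₂₃ q := fun q => by
    rw [hf₂₃]; exact integral_nonneg fun x => hf_nonneg _
  have hn₁₃ : ∀ q, 0 ≤ f₁₃ q := fun q => by
    rw [hf₁₃]; exact integral_nonneg fun y => hf_nonneg _
  have hn₃ : ∀ z, 0 ≤ f₃ z := fun z => by
    rw [hf₃']; exact integral_nonneg fun x => hn₁₃ _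
  have hi₂₃ : Integrable f₂₃ (ν.prod ρ) := by
    rw [hf₂₃]; exact hf_int.integral_prod_right
  have hi₁₃ : Integrable f₁₃ (μ.prod ρ) := by
    rw [hf₁₃]
    exact ((he.integrable_comp hf_meas.aestronglyMeasurable).2 hf_int).integral_prod_right
  have marginal₂₃ : ∀ h : Y × Z → ℝ, Measurable h →
      Integrable (fun q => f₂₃ q * h q) (ν.prod ρ) →
      Integrable (fun w => f w * h w.2) (μ.prod (ν.prod ρ)) ∧
        ∫ w, f w * h w.2 ∂(μ.prod (ν.prod ρ)) = ∫ q, f₂₃ q * h q ∂(ν.prod ρ) := by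
    intro h hh hi
    subst hf₂₃
    exact integrable_mul_comp_snd_and_integral_eq μ (ν.prod ρ) hf_meas hf_nonneg
      hf_int.prod_left_ae hh hi
  have marginal₁₃ : ∀ h : X × Z → ℝ, Measurable h →
      Integrable (fun q => f₁₃ q * h q) (μ.prod ρ) →
      Integrable (fun w => f w * h (w.1, w.2.2)) (μ.prod (ν.prod ρ)) ∧
        ∫ w, f w * h (w.1, w.2.2) ∂(μ.prod (ν.prod ρ)) = ∫ q, f₁₃ q * h q ∂(μ.prod ρ) := by
    intro h hh hi
    subst hf₁₃
    exact integrable_mul_comp_fst_thd_and_integral_eq μ ν ρ hf_meas hf_nonneg hf_int hh hi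
  have marginal₃ : ∀ h : Z → ℝ, Measurable h → Integrable (fun z => f₃ z * h z) ρ →
      Integrable (fun w => f w * h w.2.2) (μ.prod (ν.prod ρ)) ∧
        ∫ w, f w * h w.2.2 ∂(μ.prod (ν.prod ρ)) = ∫ z, f₃ z * h z ∂ρ := by
    intro h hh hi
    rw [hf₃'] at hi ⊢
    have h₁ := integrable_mul_comp_snd_and_integral_eq μ ρ hm₁₃ hn₁₃ hi₁₃.prod_left_ae hh hi
    have h₂ := marginal₁₃ (fun q => h q.2) (hh.comp measurable_snd) h₁.1
    exact ⟨h₂.1, h₂.2.trans h₁.2⟩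
  have hL₂₃ := marginal₂₃ _ hm₂₃.log hint₂₃
  have hL₁₃ := marginal₁₃ _ hm₁₃.log hint₁₃
  have hL₃ := marginal₃ _ hm₃.log hint₃
  -- A marginal vanishes only where `f` does, up to a null set: test against its zero set.
  have hind : Measurable (({0} : Set ℝ).indicator fun _ => (1 : ℝ)) :=
    measurable_const.indicator (measurableSet_singleton 0)
  have hind_nonneg : ∀ t : ℝ, 0 ≤ ({0} : Set ℝ).indicator (fun _ => (1 : ℝ)) t :=
    fun t => Set.indicator_nonneg (fun _ _ => zero_le_one) t
  have hind_mul : ∀ t : ℝ, t * ({0} : Set ℝ).indicator (fun _ => (1 : ℝ)) t = 0 := fun t => by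
    by_cases ht : t = 0 <;> simp [ht]
  have ae_zero : ∀ g : X × Y × Z → ℝ,
      Integrable (fun w => f w * ({0} : Set ℝ).indicator (fun _ => (1 : ℝ)) (g w))
        (μ.prod (ν.prod ρ)) ∧
      ∫ w, f w * ({0} : Set ℝ).indicator (fun _ => (1 : ℝ)) (g w) ∂(μ.prod (ν.prod ρ)) = 0 →
      ∀ᵐ w ∂(μ.prod (ν.prod ρ)), g w = 0 → f w = 0 := by
    rintro g ⟨hgi, hg⟩
    rw [integral_eq_zero_iff_of_nonneg
      (fun w => mul_nonneg (hf_nonneg w) (hind_nonneg _)) hgi] at hg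
    filter_upwards [hg] with w hw hgw
    simpa [hgw] using hw
  have hZ₂₃ := ae_zero (fun w => f₂₃ w.2) (by
    simpa only [Function.comp_apply, hind_mul, integral_zero] using
      marginal₂₃ _ (hind.comp hm₂₃) (by
      simp only [Function.comp_apply, hind_mul]; exact integrable_zero _ _ _))
  have hZ₁₃ := ae_zero (fun w => f₁₃ (w.1, w.2.2)) (by
    simpa only [Function.comp_apply, hind_mul, integral_zero] using
      marginal₁₃ _ (hind.comp hm₁₃) (by
      simp only [Function.comp_apply, hind_mul]; exact integrable_zero _ _ _))
  have hZ₃ := ae_zero (fun w => f₃ w.2.2) (by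
    simpa only [Function.comp_apply, hind_mul, integral_zero] using
      marginal₃ _ (hind.comp hm₃) (by
      simp only [Function.comp_apply, hind_mul]; exact integrable_zero _ _ _))
  have hle₂₃ : ∀ q : Y × Z, f₃ q.2 * (f₂₃ q / f₃ q.2) ≤ f₂₃ q := fun q => by
    rcases eq_or_ne (f₃ q.2) 0 with h0 | h0
    · simpa [h0] using hn₂₃ q
    · exact (mul_div_cancel₀ _ h0).le
  have hquot_int : Integrable (fun q : Y × Z => f₃ q.2 * (f₂₃ q / f₃ q.2)) (ν.prod ρ) := by
    refine hi₂₃.mono' (by fun_prop) (Filter.Eventually.of_forall fun q => ?_)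
    rw [Real.norm_of_nonneg (mul_nonneg (hn₃ _) (div_nonneg (hn₂₃ _) (hn₃ _)))]
    exact hle₂₃ q
  have hcond : Integrable (fun w : X × Y × Z => f₁₃ (w.1, w.2.2) * (f₂₃ w.2 / f₃ w.2.2))
        (μ.prod (ν.prod ρ)) ∧
      ∫ w : X × Y × Z, f₁₃ (w.1, w.2.2) * (f₂₃ w.2 / f₃ w.2.2) ∂(μ.prod (ν.prod ρ))
        = ∫ q : Y × Z, f₃ q.2 * (f₂₃ q / f₃ q.2) ∂(ν.prod ρ) := by
    have h := integrable_mul_comp_snd_and_integral_eq μ (ν.prod ρ)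
      (F := fun w => f₁₃ (w.1, w.2.2)) (h := fun q => f₂₃ q / f₃ q.2) (by fun_prop)
      (fun w => hn₁₃ _) (Measure.quasiMeasurePreserving_snd.ae hi₁₃.prod_left_ae)
      (by fun_prop)
    have hf₃z : ∀ z, ∫ x, f₁₃ (x, z) ∂μ = f₃ z := fun z => by rw [hf₃']
    simp only [hf₃z] at h
    exact h hquot_int
  have hcond_le : ∫ w : X × Y × Z, f₁₃ (w.1, w.2.2) * (f₂₃ w.2 / f₃ w.2.2)
      ∂(μ.prod (ν.prod ρ)) ≤ 1 := by
    have hmass := (marginal₂₃ (fun _ => 1) measurable_const (by simpa using hi₂₃)).2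
    simp only [mul_one, hf_prob] at hmass
    rw [hcond.2, hmass]
    exact integral_mono hquot_int hi₂₃ hle₂₃
  have hmono := integral_mono_ae (hf_int.sub hcond.1)
    (((hint.add hL₃.1).sub hL₁₃.1).sub hL₂₃.1) (by
      filter_upwards [hZ₂₃, hZ₁₃, hZ₃] with w h₂₃ h₁₃ h₃
      exact sub_le_mul_log_add_mul_log_sub (hf_nonneg w) (hn₁₃ _) (hn₂₃ _) (hn₃ _) h₁₃ h₂₃ h₃)
  rw [integral_sub' hf_int hcond.1, integral_sub' ((hint.add hL₃.1).sub hL₁₃.1) hL₂₃.1,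
    integral_sub' (hint.add hL₃.1) hL₁₃.1, integral_add' hint hL₃.1, hL₃.2, hL₁₃.2, hL₂₃.2,
    hf_prob] at hmono
  unfold entropyOf
  linarith
end
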